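/- arXiv:1903.00911 — 4 statements merged into one kernel-verified Lean document; each statement's English description precedes it below -/
import Mathlib

section
/- Let P be an n×n real matrix with P² = P, P ≠ 0, and P ≠ I. Then the spectral norm of P equals the spectral norm of I − P, i.e., ‖P‖₂ = ‖I − P‖₂. -/
open Matrix

/-- Spectral norm (operator norm induced by Euclidean vector norms). -/
noncomputable def spec {m n : ℕ} (M : Matrix (Fin m) (Fin n) ℝ) : ℝ :=
  ‖LinearMap.toContinuousLinearMap (Matrix.toEuclideanLin M)‖

/-- Euclidean norm of a vector. -/
noncomputable def enorm2 {n : ℕ} (v : Fin n → ℝ) : ℝ :=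
  Real.sqrt (∑ i, v i ^ 2)

theorem aux_le {E : Type*} [NormedAddCommGroup E] [InnerProductSpace ℝ E]
    (T : E →L[ℝ] E) (hT : ∀ x, T (T x) = T x) (h0 : T ≠ 0) : ‖1 - T‖ ≤ ‖T‖ := by
  refine ContinuousLinearMap.opNorm_le_bound _ (norm_nonneg _) (fun x => ?_)
  obtain ⟨u, hu⟩ : ∃ u, u = T x := ⟨_, rfl⟩
  obtain ⟨v, hv⟩ : ∃ v, v = x - T x := ⟨_, rfl⟩
  have hx : x = u + v := by rw [hu, hv]; abel
  have hTu : T u = u := by rw [hu, hT]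
  have hTv : T v = 0 := by rw [hv, map_sub, hT, sub_self]
  have e : (1 - T) x = v := by rw [hv]; rfl
  rw [e]
  by_cases hu0 : u = 0
  · have hge : 1 ≤ ‖T‖ := by
      obtain ⟨z, hz⟩ : ∃ z, T z ≠ 0 := by
        by_contra! h
        exact h0 (ContinuousLinearMap.ext h)
      have h2 := T.le_opNorm (T z)
      rw [hT] at h2
      have h3 : 0 < ‖T z‖ := norm_pos_iff.mpr hz
      nlinarith
    have : x = v := by rw [hx, hu0, zero_add]
    rw [this]
    nlinarith [norm_nonneg v]
  by_cases hv0 : v = 0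
  · rw [hv0, norm_zero]; positivity
  have hup : 0 < ‖u‖ := norm_pos_iff.mpr hu0
  have hvp : 0 < ‖v‖ := norm_pos_iff.mpr hv0
  have hy : ‖(‖v‖ / ‖u‖) • u + (‖u‖ / ‖v‖) • v‖ = ‖x‖ := by
    rw [← sq_eq_sq₀ (norm_nonneg _) (norm_nonneg _), hx, norm_add_sq_real, norm_add_sq_real,
      real_inner_smul_left, real_inner_smul_right, norm_smul, norm_smul, Real.norm_of_nonneg
      (by positivity : 0 ≤ ‖v‖ / ‖u‖), Real.norm_of_nonneg (by positivity : 0 ≤ ‖u‖ / ‖v‖)]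
    field_simp
    ring
  have h4 := T.le_opNorm ((‖v‖ / ‖u‖) • u + (‖u‖ / ‖v‖) • v)
  rw [hy, map_add, map_smul, map_smul, hTu, hTv, smul_zero, add_zero, norm_smul,
    Real.norm_of_nonneg (by positivity), div_mul_cancel₀ _ hup.ne'] at h4
  exact h4

theorem aux_spec {n : ℕ} (P : Matrix (Fin n) (Fin n) ℝ)
    (hP : P * P = P) (h0 : P ≠ 0) : spec (1 - P) ≤ spec P := by
  have h := aux_le (LinearMap.toContinuousLinearMap (Matrix.toEuclideanLin P)) (fun x => by
    simp [Matrix.toLpLin_apply, hP]) (by simpa using h0)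
  unfold spec
  convert h using 2
  ext x
  simp [Matrix.toLpLin_apply, Matrix.sub_mulVec]

/-- an oblique projector `P` (with `P ≠ 0`, `P ≠ I`) satisfies
    `‖P‖₂ = ‖I − P‖₂`. -/
theorem spec_eq_spec_one_sub_of_isIdempotent {n : ℕ} (P : Matrix (Fin n) (Fin n) ℝ)
    (hP : P * P = P) (h0 : P ≠ 0) (h1 : P ≠ 1) :
    spec P = spec (1 - P) := by
  apply le_antisymm
  · have h := aux_spec (1 - P) (by simp [mul_sub, sub_mul, hP]) (sub_ne_zero.mpr h1.symm)
    rwa [sub_sub_cancel] at h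
  · exact aux_spec P hP h0
end

section
/- Let W, S ∈ ℝ^{n×r} both have orthonormal columns and assume SᵀW is invertible. Then the DEIM projector D = W (SᵀW)⁻¹ Sᵀ satisfies ‖D‖₂ = ‖(SᵀW)⁻¹‖₂. -/
open Matrix

open scoped Matrix.Norms.L2Operator in
theorem spec_eq_norm_aux {m n : ℕ} (M : Matrix (Fin m) (Fin n) ℝ) : spec M = ‖M‖ := rfl

theorem spec_nonneg_aux {m n : ℕ} (M : Matrix (Fin m) (Fin n) ℝ) : 0 ≤ spec M :=
  norm_nonneg _

theorem spec_mul_aux {l m n : ℕ} (A : Matrix (Fin l) (Fin m) ℝ) (B : Matrix (Fin m) (Fin n) ℝ) :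
    spec (A * B) ≤ spec A * spec B := by
  simp only [spec_eq_norm_aux]
  exact Matrix.l2_opNorm_mul A B

theorem spec_transpose_aux {m n : ℕ} (M : Matrix (Fin m) (Fin n) ℝ) : spec Mᵀ = spec M := by
  simp only [spec_eq_norm_aux]
  rw [← Matrix.conjTranspose_eq_transpose_of_trivial]
  exact Matrix.l2_opNorm_conjTranspose M

open scoped Matrix.Norms.L2Operator in
theorem spec_le_one_aux {m n : ℕ} (M : Matrix (Fin m) (Fin n) ℝ) (h : Mᵀ * M = 1) :
    spec M ≤ 1 := by
  have h1 := Matrix.l2_opNorm_conjTranspose_mul_self M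
  rw [Matrix.conjTranspose_eq_transpose_of_trivial, h, ← Matrix.diagonal_one,
    Matrix.l2_opNorm_diagonal] at h1
  have h2 : ‖(1 : Fin n → ℝ)‖ ≤ 1 := by
    rw [pi_norm_le_iff_of_nonneg zero_le_one]
    intro i
    simp
  have h3 : ‖M‖ * ‖M‖ ≤ 1 := h1 ▸ h2
  rw [spec_eq_norm_aux]
  nlinarith [norm_nonneg M]

theorem spec_sandwich_aux {k l m n : ℕ} (A : Matrix (Fin k) (Fin l) ℝ)
    (B : Matrix (Fin l) (Fin m) ℝ) (C : Matrix (Fin m) (Fin n) ℝ)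
    (hA : spec A ≤ 1) (hC : spec C ≤ 1) : spec (A * B * C) ≤ spec B := by
  have hB := spec_nonneg_aux B
  calc spec (A * B * C) ≤ spec (A * B) * spec C := spec_mul_aux _ _
    _ ≤ spec (A * B) * 1 := mul_le_mul_of_nonneg_left hC (spec_nonneg_aux _)
    _ = spec (A * B) := mul_one _
    _ ≤ spec A * spec B := spec_mul_aux _ _
    _ ≤ 1 * spec B := mul_le_mul_of_nonneg_right hA hB
    _ = spec B := one_mul _

/-- for `W, S ∈ ℝ^{n×r}` with orthonormal columns and `SᵀW` invertible,
    the DEIM projector `D = W (SᵀW)⁻¹ Sᵀ` satisfies `‖D‖₂ = ‖(SᵀW)⁻¹‖₂`. -/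
theorem spec_deim_projector_eq_spec_inv {n r : ℕ}
    (W S : Matrix (Fin n) (Fin r) ℝ)
    (hW : Wᵀ * W = 1) (hS : Sᵀ * S = 1)
    (hInv : IsUnit (Sᵀ * W))
    (D : Matrix (Fin n) (Fin n) ℝ) (hD : D = W * (Sᵀ * W)⁻¹ * Sᵀ) :
    spec D = spec (Sᵀ * W)⁻¹ := by
  have hW1 := spec_le_one_aux W hW
  have hS1 := spec_le_one_aux S hS
  apply le_antisymm
  · rw [hD]
    exact spec_sandwich_aux _ _ _ hW1 ((spec_transpose_aux S).trans_le hS1)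
  · have key : Wᵀ * D * S = (Sᵀ * W)⁻¹ := by
      calc Wᵀ * D * S = (Wᵀ * W) * (Sᵀ * W)⁻¹ * (Sᵀ * S) := by
            rw [hD]; simp only [Matrix.mul_assoc]
        _ = _ := by rw [hW, hS, Matrix.one_mul, Matrix.mul_one]
    rw [← key]
    exact spec_sandwich_aux _ _ _ ((spec_transpose_aux W).trans_le hW1) hS1
end

section
/- (DEIM error bound.) Let W ∈ ℝ^{n×r} have orthonormal columns, let S ∈ ℝ^{n×s} with s ≥ r, set M = SᵀW, and assume MᵀM is invertible. Define the DEIM projector D = W (MᵀM)⁻¹ Mᵀ Sᵀ, and assume D ≠ 0 and D ≠ I. Then for every vector f ∈ ℝⁿ, ‖f − D f‖₂ ≤ ‖D‖₂ · ‖(I − WWᵀ) f‖₂. -/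
open Matrix

theorem enorm2_eq_norm {n : ℕ} (v : Fin n → ℝ) : enorm2 v = ‖(WithLp.toLp 2 v : EuclideanSpace ℝ (Fin n))‖ := by
  rw [EuclideanSpace.norm_eq]
  simp [enorm2]

theorem enorm2_sq {n : ℕ} (v : Fin n → ℝ) : enorm2 v ^ 2 = v ⬝ᵥ v := by
  rw [enorm2, Real.sq_sqrt (Finset.sum_nonneg fun i _ => sq_nonneg _)]
  simp [dotProduct, sq]

theorem enorm2_mulVec_le {n : ℕ} (D : Matrix (Fin n) (Fin n) ℝ) (v : Fin n → ℝ) :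
    enorm2 (D *ᵥ v) ≤ spec D * enorm2 v := by
  rw [enorm2_eq_norm, enorm2_eq_norm]
  exact (LinearMap.toContinuousLinearMap (Matrix.toEuclideanLin D)).le_opNorm (WithLp.toLp 2 v)

theorem dot_mulVec_le {n : ℕ} (D : Matrix (Fin n) (Fin n) ℝ) (v : Fin n → ℝ) :
    (D *ᵥ v) ⬝ᵥ (D *ᵥ v) ≤ spec D ^ 2 * (v ⬝ᵥ v) := by
  rw [← enorm2_sq, ← enorm2_sq, ← mul_pow]
  exact pow_le_pow_left₀ (Real.sqrt_nonneg _) (enorm2_mulVec_le D v) 2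

/-- DEIM error bound: `‖f − D f‖₂ ≤ ‖D‖₂ ‖(I − WWᵀ) f‖₂` for the DEIM
    projector `D = W (MᵀM)⁻¹ Mᵀ Sᵀ`, `M = SᵀW`, with `D ≠ 0` and `D ≠ I`. -/
theorem deim_error_bound {n r s : ℕ} (hrs : r ≤ s)
    (W : Matrix (Fin n) (Fin r) ℝ) (S : Matrix (Fin n) (Fin s) ℝ)
    (hW : Wᵀ * W = 1)
    (M : Matrix (Fin s) (Fin r) ℝ) (hM : M = Sᵀ * W)
    (hMinv : IsUnit (Mᵀ * M))
    (D : Matrix (Fin n) (Fin n) ℝ) (hD : D = W * (Mᵀ * M)⁻¹ * Mᵀ * Sᵀ)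
    (hD0 : D ≠ 0) (hD1 : D ≠ 1) :
    ∀ f : Fin n → ℝ,
      enorm2 (f - D.mulVec f) ≤ spec D * enorm2 ((1 - W * Wᵀ).mulVec f) := by
  intro f
  have hdet : IsUnit (Mᵀ * M).det := (Matrix.isUnit_iff_isUnit_det _).1 hMinv
  have hDW : D * W = W := by
    rw [hD]
    calc W * (Mᵀ * M)⁻¹ * Mᵀ * Sᵀ * W = W * ((Mᵀ * M)⁻¹ * (Mᵀ * (Sᵀ * W))) := by
          simp only [Matrix.mul_assoc]
      _ = W := by rw [← hM, Matrix.nonsing_inv_mul _ hdet, Matrix.mul_one]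
  have hPD : W * Wᵀ * D = D := by
    rw [hD]
    calc W * Wᵀ * (W * (Mᵀ * M)⁻¹ * Mᵀ * Sᵀ) = W * (Wᵀ * W) * (Mᵀ * M)⁻¹ * Mᵀ * Sᵀ := by
          simp only [Matrix.mul_assoc]
      _ = _ := by rw [hW, Matrix.mul_one]
  have hDD : D * D = D := by
    nth_rw 2 [← hPD]
    rw [← Matrix.mul_assoc, ← Matrix.mul_assoc, hDW, hPD]
  have hPP : W * Wᵀ * (1 - W * Wᵀ) = 0 := by
    rw [Matrix.mul_sub, Matrix.mul_one, Matrix.mul_assoc W, ← Matrix.mul_assoc Wᵀ, hW,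
      Matrix.one_mul, sub_self]
  have hred : (1 - D) * (1 - W * Wᵀ) = 1 - D := by
    have : D * (W * Wᵀ) = W * Wᵀ := by rw [← Matrix.mul_assoc, hDW]
    rw [Matrix.sub_mul, Matrix.mul_sub, Matrix.mul_sub, this]
    simp
  have hN0 : 0 ≤ spec D := norm_nonneg _
  set g := (1 - W * Wᵀ) *ᵥ f with hg
  have hfg : f - D *ᵥ f = g - D *ᵥ g := by
    have h := congrArg (fun A => A *ᵥ f) hred
    simp only [← Matrix.mulVec_mulVec, ← hg] at h
    simpa [Matrix.sub_mulVec] using h.symm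
  rw [hfg]
  have hPg : (W * Wᵀ) *ᵥ g = 0 := by
    rw [hg, Matrix.mulVec_mulVec, hPP, Matrix.zero_mulVec]
  set u := D *ᵥ g with hu
  have hDu : D *ᵥ u = u := by rw [hu, Matrix.mulVec_mulVec, hDD]
  have hPu : (W * Wᵀ) *ᵥ u = u := by rw [hu, Matrix.mulVec_mulVec, hPD]
  have hgu : g ⬝ᵥ u = 0 := by
    rw [← hPu, Matrix.dotProduct_mulVec, ← Matrix.mulVec_transpose]
    simp only [Matrix.transpose_mul, Matrix.transpose_transpose]
    rw [hPg, zero_dotProduct]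
  have hug : u ⬝ᵥ g = 0 := by rw [dotProduct_comm, hgu]
  have hG : 0 ≤ g ⬝ᵥ g := by rw [← enorm2_sq]; positivity
  have hU : 0 ≤ u ⬝ᵥ u := by rw [← enorm2_sq]; positivity
  have hone : 1 ≤ spec D ^ 2 := by
    obtain ⟨v, hv⟩ : ∃ v, D *ᵥ v ≠ 0 := by
      by_contra! h
      exact hD0 (Matrix.ext_of_mulVec_single fun i => by rw [h, Matrix.zero_mulVec])
    have h1 := dot_mulVec_le D (D *ᵥ v)
    rw [Matrix.mulVec_mulVec, hDD] at h1
    have h2 : 0 < (D *ᵥ v) ⬝ᵥ (D *ᵥ v) := by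
      refine lt_of_le_of_ne (by rw [← enorm2_sq]; positivity) ?_
      intro h
      exact hv (dotProduct_self_eq_zero.1 h.symm)
    nlinarith
  have key : g ⬝ᵥ g + u ⬝ᵥ u ≤ spec D ^ 2 * (g ⬝ᵥ g) := by
    have h := dot_mulVec_le D ((u ⬝ᵥ u) • g + (g ⬝ᵥ g) • u)
    simp only [Matrix.mulVec_add, Matrix.mulVec_smul, hDu, ← hu, add_dotProduct, dotProduct_add,
      smul_dotProduct, dotProduct_smul, hgu, hug, smul_eq_mul] at h
    generalize g ⬝ᵥ g = G at *
    generalize u ⬝ᵥ u = U at *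
    rcases hU.eq_or_lt with h0 | h0
    · rw [← h0]; nlinarith
    · have hp : 0 < U * (U + G) := by positivity
      refine le_of_mul_le_mul_left ?_ hp
      nlinarith
  refine (sq_le_sq₀ (Real.sqrt_nonneg _) (mul_nonneg hN0 (Real.sqrt_nonneg _))).1 ?_
  change enorm2 (g - u) ^ 2 ≤ (spec D * enorm2 g) ^ 2
  rw [mul_pow, enorm2_sq, enorm2_sq]
  simp only [sub_dotProduct, dotProduct_sub, hgu, hug]
  linarith
end

section
/- (Perturbed DEIM error bound.) Let W, Ŵ ∈ ℝ^{n×r} have orthonormal columns, let Ŝ ∈ ℝ^{n×s} with s ≥ r, set M̂ = ŜᵀŴ, and assume M̂ᵀM̂ is invertible. Define the perturbed DEIM projector D̂ = Ŵ (M̂ᵀM̂)⁻¹ M̂ᵀ Ŝᵀ, and assume D̂ ≠ 0 and D̂ ≠ I. Let sin θ_max := ‖(I − ŴŴᵀ) WWᵀ‖₂. Then for every f ∈ ℝⁿ, ‖f − D̂ f‖₂ ≤ ‖D̂‖₂ ( ‖(I − WWᵀ) f‖₂ + sin θ_max · ‖WWᵀ f‖₂ ). -/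
open Matrix

lemma aux_idem {E : Type*} [NormedAddCommGroup E] [InnerProductSpace ℝ E] (T : E →L[ℝ] E)
    (hT : ∀ x, T (T x) = T x) (h0 : T ≠ 0) (x : E) : ‖x - T x‖ ≤ ‖T‖ * ‖x‖ := by
  have h1 : 1 ≤ ‖T‖ := by
    have : ∃ y, T y ≠ 0 := by
      by_contra! h
      exact h0 (ContinuousLinearMap.ext h)
    obtain ⟨y, hy⟩ := this
    have h := T.le_opNorm (T y)
    rw [hT] at h
    have hp : 0 < ‖T y‖ := norm_pos_iff.mpr hy
    by_contra! hlt
    nlinarith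
  by_cases hv : x - T x = 0
  · rw [hv, norm_zero]; positivity
  by_cases hu : T x = 0
  · rw [hu, sub_zero]; nlinarith [norm_nonneg x]
  obtain ⟨u, hu'⟩ : ∃ u, u = T x := ⟨_, rfl⟩
  obtain ⟨v, hv'⟩ : ∃ v, v = x - T x := ⟨_, rfl⟩
  have hTu : T u = u := by rw [hu', hT]
  have hTv : T v = 0 := by rw [hv', map_sub, hT, sub_self]
  have hx : x = u + v := by rw [hu', hv']; abel
  rw [← hu'] at hu
  rw [← hv'] at hv ⊢
  have pu : 0 < ‖u‖ := norm_pos_iff.mpr hu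
  have pv : 0 < ‖v‖ := norm_pos_iff.mpr hv
  set y := (‖v‖ / ‖u‖) • u + (‖u‖ / ‖v‖) • v with hy
  have hTy : T y = (‖v‖ / ‖u‖) • u := by
    rw [hy, map_add, map_smul, map_smul, hTu, hTv, smul_zero, add_zero]
  have hn : ‖T y‖ = ‖v‖ := by
    rw [hTy, norm_smul, Real.norm_of_nonneg (by positivity)]
    field_simp
  have hyx : ‖y‖ = ‖x‖ := by
    have : ‖y‖ ^ 2 = ‖x‖ ^ 2 := by
      rw [hx, hy, norm_add_sq_real, norm_add_sq_real, norm_smul, norm_smul,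
        real_inner_smul_left, real_inner_smul_right,
        Real.norm_of_nonneg (by positivity), Real.norm_of_nonneg (by positivity)]
      field_simp
      ring
    exact (sq_eq_sq₀ (norm_nonneg _) (norm_nonneg _)).1 this
  have := T.le_opNorm y
  rwa [hn, hyx] at this

lemma aux_enorm {n : ℕ} (v : Fin n → ℝ) : enorm2 v = ‖WithLp.toLp 2 v‖ := by
  simp [enorm2, EuclideanSpace.norm_eq]

lemma aux_apply {m n : ℕ} (M : Matrix (Fin m) (Fin n) ℝ) (v : Fin n → ℝ) :
    LinearMap.toContinuousLinearMap (Matrix.toEuclideanLin M) (WithLp.toLp 2 v)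
      = WithLp.toLp 2 (M.mulVec v) := rfl

lemma aux_spec_s5 {m n : ℕ} (M : Matrix (Fin m) (Fin n) ℝ) (v : Fin n → ℝ) :
    enorm2 (M.mulVec v) ≤ spec M * enorm2 v := by
  rw [aux_enorm, aux_enorm, ← aux_apply]
  exact ContinuousLinearMap.le_opNorm _ _

lemma aux_contr {n r : ℕ} (V : Matrix (Fin n) (Fin r) ℝ) (hV : Vᵀ * V = 1) (x : Fin n → ℝ) :
    enorm2 ((1 - V * Vᵀ).mulVec x) ≤ enorm2 x := by
  have e : ∀ {k : ℕ} (v : Fin k → ℝ), ∑ i, v i ^ 2 = v ⬝ᵥ v := by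
    intro k v; simp [dotProduct, sq]
  unfold enorm2
  apply Real.sqrt_le_sqrt
  rw [e, e]
  have h1 : (1 - V * Vᵀ)ᵀ * (1 - V * Vᵀ) = 1 - V * Vᵀ := by
    have : V * Vᵀ * (V * Vᵀ) = V * Vᵀ := by
      rw [Matrix.mul_assoc, ← Matrix.mul_assoc Vᵀ, hV, Matrix.one_mul]
    simp [Matrix.transpose_sub, Matrix.transpose_mul, Matrix.sub_mul, Matrix.mul_sub, this]
  have h2 : (1 - V * Vᵀ).mulVec x ⬝ᵥ (1 - V * Vᵀ).mulVec x
      = x ⬝ᵥ x - (Vᵀ.mulVec x) ⬝ᵥ (Vᵀ.mulVec x) := by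
    rw [Matrix.dotProduct_mulVec, ← Matrix.mulVec_transpose, Matrix.mulVec_mulVec, h1,
      Matrix.sub_mulVec, Matrix.one_mulVec, sub_dotProduct, Matrix.dotProduct_mulVec (Vᵀ *ᵥ x),
      ← Matrix.mulVec_transpose, Matrix.mulVec_mulVec, Matrix.transpose_transpose]
  rw [h2, ← e (Vᵀ.mulVec x)]
  have : 0 ≤ ∑ i, (Vᵀ.mulVec x) i ^ 2 := Finset.sum_nonneg fun i _ => sq_nonneg _
  linarith

/-- perturbed DEIM error bound: for the perturbed DEIM projector
    `D̂ = Ŵ (M̂ᵀM̂)⁻¹ M̂ᵀ Ŝᵀ`, `M̂ = ŜᵀŴ`, with `sin θ_max = ‖(I − ŴŴᵀ)WWᵀ‖₂`,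
    `‖f − D̂ f‖₂ ≤ ‖D̂‖₂ (‖(I − WWᵀ)f‖₂ + sin θ_max ‖WWᵀ f‖₂)`. -/
theorem perturbed_deim_error_bound {n r s : ℕ} (hrs : r ≤ s)
    (W What : Matrix (Fin n) (Fin r) ℝ) (Shat : Matrix (Fin n) (Fin s) ℝ)
    (hW : Wᵀ * W = 1) (hWhat : Whatᵀ * What = 1)
    (Mhat : Matrix (Fin s) (Fin r) ℝ) (hMhat : Mhat = Shatᵀ * What)
    (hMinv : IsUnit (Mhatᵀ * Mhat))
    (Dhat : Matrix (Fin n) (Fin n) ℝ)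
    (hDhat : Dhat = What * (Mhatᵀ * Mhat)⁻¹ * Mhatᵀ * Shatᵀ)
    (hD0 : Dhat ≠ 0) (hD1 : Dhat ≠ 1)
    (sinθ : ℝ) (hsinθ : sinθ = spec ((1 - What * Whatᵀ) * (W * Wᵀ))) :
    ∀ f : Fin n → ℝ,
      enorm2 (f - Dhat.mulVec f) ≤
        spec Dhat *
          (enorm2 ((1 - W * Wᵀ).mulVec f) + sinθ * enorm2 ((W * Wᵀ).mulVec f)) := by
  intro f
  have hDW : Dhat * What = What := by
    rw [hDhat, Matrix.mul_assoc _ Shatᵀ, ← hMhat, Matrix.mul_assoc _ Mhatᵀ, Matrix.mul_assoc What,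
      Matrix.nonsing_inv_mul _ ((Matrix.isUnit_iff_isUnit_det _).1 hMinv), Matrix.mul_one]
  have hDD : Dhat * Dhat = Dhat := by
    have : ∀ X : Matrix (Fin r) (Fin n) ℝ, Dhat * (What * X) = What * X := by
      intro X; rw [← Matrix.mul_assoc, hDW]
    have h2 : Dhat = What * ((Mhatᵀ * Mhat)⁻¹ * Mhatᵀ * Shatᵀ) := by
      rw [hDhat]; simp only [Matrix.mul_assoc]
    conv_lhs => rw [show Dhat * Dhat = Dhat * (What * ((Mhatᵀ * Mhat)⁻¹ * Mhatᵀ * Shatᵀ)) by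
      rw [← h2]]
    rw [this, ← h2]
  have hspec : ∀ x : Fin n → ℝ, enorm2 (x - Dhat.mulVec x) ≤ spec Dhat * enorm2 x := by
    intro x
    have := aux_idem (LinearMap.toContinuousLinearMap (Matrix.toEuclideanLin Dhat))
      (by
        intro x
        rw [show x = WithLp.toLp 2 (x.ofLp) from rfl, aux_apply, aux_apply,
          Matrix.mulVec_mulVec, hDD])
      (by
        intro h
        apply hD0
        rw [map_eq_zero_iff _ (LinearEquiv.injective _)] at h
        exact (map_eq_zero_iff _ (LinearEquiv.injective _)).1 h)
      (WithLp.toLp 2 x)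
    rw [aux_apply, ← WithLp.toLp_sub, ← aux_enorm, ← aux_enorm] at this
    exact this
  have hP : W * Wᵀ * (W * Wᵀ) = W * Wᵀ := by
    rw [Matrix.mul_assoc, ← Matrix.mul_assoc Wᵀ, hW, Matrix.one_mul]
  have hkey : f - Dhat.mulVec f
      = (1 - What * Whatᵀ).mulVec f - Dhat.mulVec ((1 - What * Whatᵀ).mulVec f) := by
    rw [Matrix.mulVec_mulVec, Matrix.mul_sub, ← Matrix.mul_assoc, hDW, Matrix.mul_one,
      Matrix.sub_mulVec, Matrix.sub_mulVec, Matrix.one_mulVec]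
    abel
  rw [hkey]
  refine (hspec _).trans (mul_le_mul_of_nonneg_left ?_ (norm_nonneg _))
  have hsplit : (1 - What * Whatᵀ).mulVec f
      = (1 - What * Whatᵀ).mulVec ((1 - W * Wᵀ).mulVec f)
        + ((1 - What * Whatᵀ) * (W * Wᵀ)).mulVec ((W * Wᵀ).mulVec f) := by
    rw [Matrix.mulVec_mulVec, Matrix.mulVec_mulVec, Matrix.mul_assoc _ (W * Wᵀ) (W * Wᵀ), hP,
      ← Matrix.add_mulVec, ← Matrix.mul_add, sub_add_cancel, Matrix.mul_one]
  have htri : ∀ a b : Fin n → ℝ, enorm2 (a + b) ≤ enorm2 a + enorm2 b := by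
    intro a b
    rw [aux_enorm, aux_enorm, aux_enorm, WithLp.toLp_add]
    exact norm_add_le _ _
  rw [hsplit, hsinθ]
  exact (htri _ _).trans (add_le_add (aux_contr _ hWhat _) (aux_spec_s5 _ _))
end
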